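/- Let (λ_m)_{m≥0} be a real sequence with λ_m = 3·(5−λ_{m+1})·(4−λ_{m+1})·(3−λ_{m+1})·λ_{m+1}/(14 − 3λ_{m+1}) for all m ≥ 0, such that φ(λ_m) ≠ 0 and 14 − 3λ_m ≠ 0 for all m, λ_0 ≠ 0, λ_0 ≠ 4, and (90/7)^m·λ_m → (2/3)·λ as m → ∞. Define x_0 = 1 and x_{m+1} = 1 − α(λ_{m+1}) − δ(λ_{m+1}) + δ(λ_{m+1})·x_m. Then for every m ≥ 0, x_m = ((4−λ_0)/(4λ_0)) · (λ_0/(4−λ_0) + ∏_{j=1}^m (4−λ_j)(6−λ_j)/(4 − 6λ_j + λ_j²)) · λ_m, and moreover lim_{m→∞} (15/7)^m · 2·x_m = ((4 − λ_0)/2) · τ(λ), the infinite product defining τ(λ) being convergent. -/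

import Mathlib

open Filter Topology

/-- `φ(λ) = 3(5−λ)(3−λ)(4−6λ+λ²)` for `SG₃`. -/
noncomputable def phiSG3 (l : ℝ) : ℝ := 3 * (5 - l) * (3 - l) * (4 - 6*l + l^2)

/-- `α(λ) = (96 − 109λ + 33λ² − 3λ³)/φ(λ)`. -/
noncomputable def alphaSG3 (l : ℝ) : ℝ := (96 - 109*l + 33*l^2 - 3*l^3) / phiSG3 l

/-- `δ(λ) = (14 − 3λ)(6 − λ)/φ(λ)`. -/
noncomputable def deltaSG3 (l : ℝ) : ℝ := (14 - 3*l) * (6 - l) / phiSG3 l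

/-- One step of the recursion for `x_m` preserves the form `(1/4 + C P_m) λ_m`. -/
lemma sg3_step (l lm D : ℝ) (hphi : phiSG3 l ≠ 0) (h14 : 14 - 3 * l ≠ 0)
    (hlm : lm = 3 * (5 - l) * (4 - l) * (3 - l) * l / (14 - 3 * l)) :
    1 - alphaSG3 l - deltaSG3 l + deltaSG3 l * ((1 / 4 + D) * lm) =
      (1 / 4 + D * ((4 - l) * (6 - l) / (4 - 6 * l + l ^ 2))) * l := by
  have h5 : 5 - l ≠ 0 := by rintro h; simp [phiSG3, h] at hphi
  have h3 : 3 - l ≠ 0 := by rintro h; simp [phiSG3, h] at hphi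
  have hq : 4 - 6 * l + l ^ 2 ≠ 0 := by rintro h; simp [phiSG3, h] at hphi
  rw [hlm, alphaSG3, deltaSG3, phiSG3]
  obtain ⟨q, hq_eq⟩ : ∃ q, q = 4 - 6 * l + l ^ 2 := ⟨_, rfl⟩
  obtain ⟨r, hr_eq⟩ : ∃ r, r = 14 - 3 * l := ⟨_, rfl⟩
  rw [← hq_eq] at hq ⊢
  rw [← hr_eq] at h14 ⊢
  field_simp
  subst hq_eq hr_eq
  ring

/-- A product over `{1, …, n}` whose factors are `g (u j)` converges when `g` is differentiable at
`0` with `g 0 = 1` and `u` is summable. -/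
lemma exists_tendsto_prod_Icc_of_summable {u : ℕ → ℝ} {g : ℝ → ℝ} (hu : Summable u)
    (hg : DifferentiableAt ℝ g 0) (hg0 : g 0 = 1) :
    ∃ p : ℝ, Tendsto (fun n : ℕ => ∏ j ∈ Finset.Icc 1 n, g (u j)) atTop (𝓝 p) := by
  have hO : (fun j => g (u j) - 1) =O[atTop] u := by
    simpa [Function.comp_def, hg0] using hg.isBigO_sub.comp_tendsto hu.tendsto_atTop_zero
  have hs : Summable fun j => ‖g (u (j + 1)) - 1‖ :=
    (summable_nat_add_iff 1).2 (summable_of_isBigO_nat hu.norm hO.norm_norm)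
  have hm := (multipliable_one_add_of_summable hs).tendsto_prod_tprod_nat
  refine ⟨_, hm.congr fun n => ?_⟩
  induction n with
  | zero => simp
  | succ n ih => rw [Finset.prod_range_succ, ih, Finset.prod_Icc_succ_top (by omega)]; simp

/-- Closed form and limit of the sequence `x_m` giving the normal derivative
`∂ₙu(q₀) = ((4−λ₀)/2)·τ(λ)` on `SG₃`, where `τ(λ) = (2λ/(3λ₀))·∏_{j≥1}(…)`. -/
theorem sg3_normal_derivative_q0
    (lam : ℕ → ℝ) (L : ℝ)
    (hrec : ∀ m : ℕ, lam m =
      3 * (5 - lam (m+1)) * (4 - lam (m+1)) * (3 - lam (m+1)) * lam (m+1) /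
        (14 - 3 * lam (m+1)))
    (hphi : ∀ m : ℕ, phiSG3 (lam m) ≠ 0)
    (h14 : ∀ m : ℕ, 14 - 3 * lam m ≠ 0)
    (h0 : lam 0 ≠ 0) (h4 : lam 0 ≠ 4)
    (hlim : Tendsto (fun m : ℕ => (90/7 : ℝ) ^ m * lam m) atTop (𝓝 (2/3 * L)))
    (x : ℕ → ℝ) (hx0 : x 0 = 1)
    (hxs : ∀ m : ℕ, x (m+1) =
      1 - alphaSG3 (lam (m+1)) - deltaSG3 (lam (m+1)) + deltaSG3 (lam (m+1)) * x m) :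
    (∀ m : ℕ, x m =
      (4 - lam 0) / (4 * lam 0) *
        (lam 0 / (4 - lam 0) +
          ∏ j ∈ Finset.Icc 1 m, (4 - lam j) * (6 - lam j) / (4 - 6 * lam j + (lam j)^2)) *
        lam m) ∧
    ∃ p : ℝ,
      Tendsto (fun n : ℕ => ∏ j ∈ Finset.Icc 1 n,
          ((1 - lam j / 4) * (1 - lam j / 6) / (1 - 3/2 * lam j + (lam j)^2 / 4)))
        atTop (𝓝 p) ∧
      Tendsto (fun m : ℕ => (15/7 : ℝ) ^ m * (2 * x m)) atTop
        (𝓝 ((4 - lam 0) / 2 * (2 * L / (3 * lam 0) * p))) := by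
  have hC : (4 - lam 0) / (4 * lam 0) * (lam 0 / (4 - lam 0)) = 1 / 4 := by
    have : 4 - lam 0 ≠ 0 := sub_ne_zero.2 h4.symm
    field_simp
  have hclosed : ∀ m : ℕ, x m = (1 / 4 + (4 - lam 0) / (4 * lam 0) *
      ∏ j ∈ Finset.Icc 1 m, (4 - lam j) * (6 - lam j) / (4 - 6 * lam j + (lam j)^2)) * lam m := by
    intro m
    induction m with
    | zero =>
      rw [hx0]
      simp only [zero_lt_one, Finset.Icc_eq_empty_of_lt, Finset.prod_empty]
      field_simp
      ring
    | succ m ih =>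
      rw [hxs, ih, sg3_step _ _ _ (hphi _) (h14 _) (hrec m),
        Finset.prod_Icc_succ_top (by omega), mul_assoc ((4 - lam 0) / (4 * lam 0))]
  refine ⟨fun m => by rw [hclosed, mul_add, hC], ?_⟩
  have hsum : Summable lam := by
    have hO : lam =O[atTop] fun m : ℕ => (7/90 : ℝ) ^ m := by
      have h := (Asymptotics.isBigO_refl (fun m : ℕ => (7/90 : ℝ) ^ m) atTop).mul
        (hlim.isBigO_one ℝ)
      simpa [← mul_assoc, ← mul_pow] using h
    exact summable_of_isBigO_nat
      (summable_geometric_of_lt_one (by norm_num) (by norm_num)) hO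
  have hdiff : DifferentiableAt ℝ
      (fun l : ℝ => (1 - l / 4) * (1 - l / 6) / (1 - 3/2 * l + l^2 / 4)) 0 := by
    refine DifferentiableAt.div (by fun_prop) (by fun_prop) (by norm_num)
  obtain ⟨p, hp⟩ := exists_tendsto_prod_Icc_of_summable hsum hdiff (by norm_num)
  refine ⟨p, hp, ?_⟩
  have hprod : ∀ m : ℕ,
      ∏ j ∈ Finset.Icc 1 m, (4 - lam j) * (6 - lam j) / (4 - 6 * lam j + (lam j)^2) =
      6 ^ m * ∏ j ∈ Finset.Icc 1 m,
        ((1 - lam j / 4) * (1 - lam j / 6) / (1 - 3/2 * lam j + (lam j)^2 / 4)) := by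
    intro m
    have hcard : (6 : ℝ) ^ m = ∏ _j ∈ Finset.Icc 1 m, (6 : ℝ) := by simp
    rw [hcard, ← Finset.prod_mul_distrib]
    refine Finset.prod_congr rfl fun j _ => ?_
    rw [show 4 - 6 * lam j + (lam j)^2 = 4 * (1 - 3/2 * lam j + (lam j)^2 / 4) by ring,
      show (4 - lam j) * (6 - lam j) = 4 * (6 * ((1 - lam j / 4) * (1 - lam j / 6))) by ring,
      mul_div_mul_left _ _ (by norm_num), mul_div_assoc]
  have hsmall : Tendsto (fun m : ℕ => (15/7 : ℝ) ^ m * lam m) atTop (𝓝 0) := by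
    have h := (tendsto_pow_atTop_nhds_zero_of_lt_one (r := (1/6 : ℝ)) (by norm_num)
      (by norm_num)).mul hlim
    rw [zero_mul] at h
    refine h.congr fun m => ?_
    rw [← mul_assoc, ← mul_pow]
    norm_num
  have h := (hsmall.const_mul (1/2)).add
    ((hp.mul hlim).const_mul (2 * ((4 - lam 0) / (4 * lam 0))))
  convert h using 2 with m
  · rw [hclosed, hprod, show (90/7 : ℝ) = 15/7 * 6 by norm_num, mul_pow]
    ring
  · field_simp
    ring
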